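/- Consider the linear program: maximize 1ᵀt⁻ + 1ᵀt⁺ subject to δ ≥ 0, 1ᵀδ ≥ 1, Xδ + t⁻ ≤ (1ᵀδ)x₀, Yδ - t⁺ ≥ (1ᵀδ)y₀, 0 ≤ t⁻ ≤ 1, 0 ≤ t⁺ ≤ 1. If (δ*, t⁻*, t⁺*) is an optimal solution, then every positive component of t⁻* equals 1 and every positive component of t⁺* equals 1. -/

import Mathlib

/-- Feasibility for system (14). -/
def Feasible {m s k : ℕ} (X : Matrix (Fin m) (Fin k) ℝ) (Y : Matrix (Fin s) (Fin k) ℝ)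
    (x₀ : Fin m → ℝ) (y₀ : Fin s → ℝ)
    (δ : Fin k → ℝ) (tm : Fin m → ℝ) (tp : Fin s → ℝ) : Prop :=
  0 ≤ δ ∧ 1 ≤ ∑ j, δ j ∧ X.mulVec δ + tm ≤ (∑ j, δ j) • x₀ ∧
    (∑ j, δ j) • y₀ ≤ Y.mulVec δ - tp ∧ 0 ≤ tm ∧ tm ≤ 1 ∧ 0 ≤ tp ∧ tp ≤ 1

/-- Lemma 3.2: at an optimal solution of the LP (15), every positive
component of `t⁻` and of `t⁺` equals `1`. -/
theorem stmt_6 {m s k : ℕ} (X : Matrix (Fin m) (Fin k) ℝ) (Y : Matrix (Fin s) (Fin k) ℝ)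
    (hX : ∀ i j, 0 ≤ X i j) (hY : ∀ i j, 0 ≤ Y i j)
    (x₀ : Fin m → ℝ) (y₀ : Fin s → ℝ) (hx₀ : 0 ≤ x₀) (hy₀ : 0 ≤ y₀)
    (δ : Fin k → ℝ) (tm : Fin m → ℝ) (tp : Fin s → ℝ)
    (hfeas : Feasible X Y x₀ y₀ δ tm tp)
    (hopt : ∀ δ' tm' tp', Feasible X Y x₀ y₀ δ' tm' tp' →
      ∑ i, tm' i + ∑ r, tp' r ≤ ∑ i, tm i + ∑ r, tp r) :
    (∀ i, 0 < tm i → tm i = 1) ∧ (∀ r, 0 < tp r → tp r = 1) := by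
  obtain ⟨h1, h2, h3, h4, h5, h6, h7, h8⟩ := hfeas
  have hs : ∑ j, ((2 : ℝ) • δ) j = 2 * ∑ j, δ j := by
    simp [Finset.mul_sum]
  have key := hopt ((2 : ℝ) • δ) (fun i => min (2 * tm i) 1) (fun r => min (2 * tp r) 1) (by
    refine ⟨?_, ?_, ?_, ?_, ?_, ?_, ?_, ?_⟩
    · intro j
      have := h1 j
      simp at this ⊢
      exact this
    · rw [hs]; linarith
    · intro i
      have a := h3 i
      have b := min_le_left (2 * tm i) 1
      rw [hs, Matrix.mulVec_smul]
      simp only [Pi.add_apply, Pi.smul_apply, smul_eq_mul] at a ⊢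
      linarith
    · intro r
      have a := h4 r
      have b := min_le_left (2 * tp r) 1
      rw [hs, Matrix.mulVec_smul]
      simp only [Pi.sub_apply, Pi.smul_apply, smul_eq_mul] at a ⊢
      linarith
    · intro i
      have a : 0 ≤ tm i := h5 i
      exact le_min (by simpa using a) zero_le_one
    · intro i
      exact min_le_right _ _
    · intro i
      have a : 0 ≤ tp i := h7 i
      exact le_min (by simpa using a) zero_le_one
    · intro i
      exact min_le_right _ _)
  have lm : ∀ i ∈ Finset.univ, tm i ≤ min (2 * tm i) 1 := by
    intro i _
    have a : 0 ≤ tm i := h5 i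
    exact le_min (by linarith) (h6 i)
  have lp : ∀ i ∈ Finset.univ, tp i ≤ min (2 * tp i) 1 := by
    intro i _
    have a : 0 ≤ tp i := h7 i
    exact le_min (by linarith) (h8 i)
  have sm := Finset.sum_le_sum lm
  have sp := Finset.sum_le_sum lp
  have em := (Finset.sum_eq_sum_iff_of_le lm).1 (by linarith)
  have ep := (Finset.sum_eq_sum_iff_of_le lp).1 (by linarith)
  constructor
  · intro i hi
    have e := em i (Finset.mem_univ i)
    rcases min_choice (2 * tm i) 1 with h | h <;> rw [h] at e <;> linarith
  · intro i hi
    have e := ep i (Finset.mem_univ i)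
    rcases min_choice (2 * tp i) 1 with h | h <;> rw [h] at e <;> linarith
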